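/- Let λ and μ be partitions, let n ∈ ℕ be such that λ_i = μ_i = 0 for all i > n, and let k ∈ {0,…,n} be such that k = 0 or μ_k ≥ λ_{k+1}. Let λ^{≤k} := (λ_1,…,λ_k), μ^{≤k} := (μ_1,…,μ_k), λ^{>k} := (λ_{k+1},…,λ_n), and μ^{>k} := (μ_{k+1},…,μ_n), regarded as partitions. Then S_n(λ,μ;0) = S_k(λ^{≤k}, μ^{≤k}; 0) · S_{n−k}(λ^{>k}, μ^{>k}; −k). -/

import Mathlib

/-- The base ring of the ninth variation: polynomials over `ℤ` in indeterminates
`X_{(r,s)}` indexed by pairs of a positive integer `r` and an integer `s`. -/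
abbrev NinthR : Type := MvPolynomial ({r : ℤ // 0 < r} × ℤ) ℤ

/-- `hfun r s` is `h_{r,s}`: the indeterminate `X_{(r,s)}` if `r > 0`, `1` if `r = 0`,
and `0` if `r < 0`. -/
noncomputable def hfun (r s : ℤ) : NinthR :=
  if hr : 0 < r then MvPolynomial.X (⟨r, hr⟩, s) else if r = 0 then 1 else 0

/-- The ninth-variation skew Schur function `S_n(λ,μ;s)`: the determinant of the
`n × n` matrix whose `(i,j)` entry (`1 ≤ i,j ≤ n`, here encoded by `Fin n` with the
`1`-based index `(i : ℕ) + 1`) is `h(λ_i − μ_j − i + j, μ_j − j + 1 + s)`.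
Partitions are encoded as functions `ℕ → ℕ` whose relevant values are at indices
`1, 2, 3, …`. -/
noncomputable def Svar (n : ℕ) (l m : ℕ → ℕ) (s : ℤ) : NinthR :=
  Matrix.det (Matrix.of fun i j : Fin n =>
    hfun ((l ((i : ℕ) + 1) : ℤ) - (m ((j : ℕ) + 1) : ℤ)
        - (((i : ℕ) : ℤ) + 1) + (((j : ℕ) : ℤ) + 1))
      ((m ((j : ℕ) + 1) : ℤ) - (((j : ℕ) : ℤ) + 1) + 1 + s))

theorem hfun_of_neg {r : ℤ} (s : ℤ) (hr : r < 0) : hfun r s = 0 := by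
  rw [hfun, dif_neg (by omega), if_neg (by omega)]

/-- A sequence that weakly decreases from index `1` on is antitone on positive indices. -/
theorem apply_le_of_succ_le {f : ℕ → ℕ} (hf : ∀ i, 1 ≤ i → f (i + 1) ≤ f i)
    {a b : ℕ} (ha : 1 ≤ a) (hab : a ≤ b) : f b ≤ f a := by
  induction b, hab using Nat.le_induction with
  | base => exact le_rfl
  | succ b hab ih => exact (hf b (ha.trans hab)).trans ih

/-- Factorization of the ninth-variation skew Schur function: if
`λ, μ` are partitions with parts vanishing beyond `n`, and `k ∈ {0,…,n}` satisfies
`k = 0` or `μ_k ≥ λ_{k+1}`, then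
`S_n(λ,μ;0) = S_k(λ^{≤k},μ^{≤k};0) · S_{n−k}(λ^{>k},μ^{>k};−k)`.
Since `S_k` only reads the first `k` parts, `λ^{≤k} = (λ_1,…,λ_k)` is represented by
`l` itself, and `λ^{>k} = (λ_{k+1},…,λ_n)` by the shift `fun i => l (i + k)`. -/
theorem stmt_17 (l μ : ℕ → ℕ)
    (hl : ∀ i, 1 ≤ i → l (i + 1) ≤ l i) (hμ : ∀ i, 1 ≤ i → μ (i + 1) ≤ μ i)
    (n : ℕ) (hn : ∀ i, n < i → l i = 0 ∧ μ i = 0)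
    (k : ℕ) (hk : k ≤ n) (hk0 : k = 0 ∨ l (k + 1) ≤ μ k) :
    Svar n l μ 0 =
      Svar k l μ 0 * Svar (n - k) (fun i => l (i + k)) (fun i => μ (i + k)) (-(k : ℤ)) := by
  obtain ⟨m, rfl⟩ := Nat.exists_eq_add_of_le hk
  rw [Nat.add_sub_cancel_left]
  unfold Svar
  rw [← Matrix.det_submatrix_equiv_self finSumFinEquiv, ← Matrix.det_fromBlocks_zero₂₁ _
    (Matrix.of fun (i : Fin k) (j : Fin m) =>
      hfun ((l ((i : ℕ) + 1) : ℤ) - (μ (k + (j : ℕ) + 1) : ℤ) - ((i : ℕ) + 1) + (k + (j : ℕ) + 1))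
        ((μ (k + (j : ℕ) + 1) : ℤ) - (k + (j : ℕ) + 1) + 1 + 0))]
  congr 1
  ext1 i j
  rcases i with i | i <;> rcases j with j | j
  · simp
  · simp
  · have hi : l (k + i + 1) ≤ l (k + 1) := apply_le_of_succ_le hl (by omega) (by omega)
    have hj : μ k ≤ μ (j + 1) := apply_le_of_succ_le hμ (by omega) (by omega)
    simp only [Matrix.submatrix_apply, Matrix.of_apply, finSumFinEquiv_apply_left,
      finSumFinEquiv_apply_right, Fin.val_castAdd, Fin.val_natAdd, Matrix.fromBlocks_apply₂₁,
      Matrix.zero_apply]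
    exact hfun_of_neg _ (by omega)
  · simp only [Matrix.submatrix_apply, Matrix.of_apply, finSumFinEquiv_apply_right,
      Fin.val_natAdd, Matrix.fromBlocks_apply₂₂]
    rw [show k + (i : ℕ) + 1 = i + 1 + k by ring, show k + (j : ℕ) + 1 = j + 1 + k by ring]
    push_cast
    congr 1 <;> ring
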